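/- p-th moment bound for the ratio term: Let X and Y be independent Gamma(𝔞,𝔟)-distributed random variables, let p > 𝔞, 𝑓 > 0 small, and τ > 0. Then there is a constant C (independent of p, 𝑓, τ) such that E[ (𝑓 Y/X)^p 1{X > 𝑓Y} 1{Y ≤ τ} ] ≤ C ( 𝑓^𝔞/(p−𝔞) + 𝑓^p τ^{(p−𝔞)∨0} ). -/

import Mathlib

open MeasureTheory ProbabilityTheory Filter Finset

noncomputable section

open scoped ENNReal

theorem measurable_gammaPDF (a r : ℝ) : Measurable (gammaPDF a r) :=
  (measurable_gammaPDFReal a r).ennreal_ofReal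

theorem ae_pos_gammaMeasure (a r : ℝ) : ∀ᵐ x ∂gammaMeasure a r, 0 < x := by
  rw [gammaMeasure, ae_withDensity_iff (measurable_gammaPDF a r)]
  filter_upwards [Measure.ae_ne volume (0 : ℝ)] with x hx0 hx
  exact lt_of_le_of_ne (not_lt.1 fun h => hx (gammaPDF_of_neg h)) hx0.symm

theorem lintegral_rpow_gammaMeasure {a r s : ℝ} (ha : 0 < a) (hr : 0 < r) (hs : 0 < a + s) :
    ∫⁻ x, ENNReal.ofReal (x ^ s) ∂gammaMeasure a r
      = ENNReal.ofReal (Real.Gamma (a + s) / (Real.Gamma a * r ^ s)) := by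
  have hΓ := Real.Gamma_pos_of_pos ha
  have hΓs := Real.Gamma_pos_of_pos hs
  have hpdf : ∀ᵐ x : ℝ, gammaPDF a r x * ENNReal.ofReal (x ^ s) =
      ENNReal.ofReal (Real.Gamma (a + s) / (Real.Gamma a * r ^ s)) * gammaPDF (a + s) r x := by
    filter_upwards [Measure.ae_ne volume (0 : ℝ)] with x hx0
    rcases lt_or_gt_of_ne hx0 with hx | hx
    · simp [gammaPDF_of_neg hx]
    · rw [gammaPDF_of_nonneg hx.le, gammaPDF_of_nonneg hx.le,
        ← ENNReal.ofReal_mul (by positivity), ← ENNReal.ofReal_mul (by positivity),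
        show a + s - 1 = (a - 1) + s by ring, Real.rpow_add hx, Real.rpow_add hr]
      congr 1
      field_simp
  rw [gammaMeasure, lintegral_withDensity_eq_lintegral_mul _ (measurable_gammaPDF a r)
    (by fun_prop)]
  simp only [Pi.mul_apply]
  rw [lintegral_congr_ae hpdf, lintegral_const_mul _ (measurable_gammaPDF _ r),
    lintegral_gammaPDF_eq_one hs hr, mul_one]

theorem setLIntegral_Ioi_div_rpow_gammaMeasure_le {a r p t : ℝ} (ha : 0 < a) (hr : 0 < r)
    (hp : a < p) (ht : 0 < t) :
    ∫⁻ x in Set.Ioi t, ENNReal.ofReal ((t / x) ^ p) ∂gammaMeasure a r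
      ≤ ENNReal.ofReal (r ^ a / Real.Gamma a / (p - a) * t ^ a) := by
  have hΓ := Real.Gamma_pos_of_pos ha
  have hpa : p - a ≠ 0 := (sub_pos.2 hp).ne'
  have hpdf : ∀ x ∈ Set.Ioi t, gammaPDF a r x * ENNReal.ofReal ((t / x) ^ p) ≤
      ENNReal.ofReal (r ^ a / Real.Gamma a * t ^ p * x ^ (a - 1 - p)) := by
    intro x hx
    have hx0 : 0 < x := ht.trans hx
    rw [gammaPDF_of_nonneg hx0.le, ← ENNReal.ofReal_mul (by positivity)]
    refine ENNReal.ofReal_le_ofReal ?_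
    rw [Real.div_rpow ht.le hx0.le, Real.rpow_sub hx0 (a - 1) p]
    calc _ = r ^ a / Real.Gamma a * t ^ p * (x ^ (a - 1) / x ^ p) * Real.exp (-(r * x)) := by ring
      _ ≤ _ := mul_le_of_le_one_right (by positivity) (Real.exp_le_one_iff.2 (by nlinarith))
  rw [gammaMeasure, restrict_withDensity measurableSet_Ioi,
    lintegral_withDensity_eq_lintegral_mul _ (measurable_gammaPDF a r) (by fun_prop)]
  refine (setLIntegral_mono' measurableSet_Ioi hpdf).trans_eq ?_
  rw [← ofReal_integral_eq_lintegral_ofReal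
    ((integrableOn_Ioi_rpow_of_lt (by linarith) ht).const_mul _)
    (ae_restrict_of_forall_mem measurableSet_Ioi fun x hx => by
      have hx0 : 0 < x := ht.trans hx
      positivity),
    integral_const_mul, integral_Ioi_rpow_of_lt (by linarith) ht]
  congr 1
  rw [show a - 1 - p + 1 = -(p - a) by ring, neg_div_neg_eq, Real.rpow_neg ht.le,
    Real.rpow_sub ht]
  field_simp

/-- Lemma: `p`-th moment bound for the ratio term.
For independent `Gamma(𝔞,𝔟)` variables `X, Y`, exponents `p > 𝔞`, small `𝑓 > 0` and
`τ > 0`: `E[(𝑓 Y/X)^p 1{X > 𝑓Y} 1{Y ≤ τ}] ≤ C (𝑓^𝔞/(p-𝔞) + 𝑓^p τ^{(p-𝔞)∨0})`,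
with `C` independent of `p, 𝑓, τ`. -/
theorem ratio_moment_bound
    {Ω : Type} [MeasurableSpace Ω] (P : Measure Ω) [IsProbabilityMeasure P]
    (X Y : Ω → ℝ) (hX : Measurable X) (hY : Measurable Y)
    (hindep : IndepFun X Y P)
    (𝔞 𝔟 : ℝ) (h𝔞 : 0 < 𝔞) (h𝔟 : 0 < 𝔟)
    (hXg : Measure.map X P = gammaMeasure 𝔞 𝔟)
    (hYg : Measure.map Y P = gammaMeasure 𝔞 𝔟) :
    ∃ C f₀ : ℝ, 0 < C ∧ 0 < f₀ ∧
      ∀ (p c τ : ℝ), 𝔞 < p → 0 < c → c ≤ f₀ → 0 < τ →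
        (∫ ω, (c * Y ω / X ω) ^ p *
            (if c * Y ω < X ω ∧ Y ω ≤ τ then (1 : ℝ) else 0) ∂P)
          ≤ C * (c ^ 𝔞 / (p - 𝔞) + c ^ p * τ ^ max (p - 𝔞) 0) := by
  have hΓ := Real.Gamma_pos_of_pos h𝔞
  have hΓ2 := Real.Gamma_pos_of_pos (add_pos h𝔞 h𝔞)
  refine ⟨Real.Gamma (𝔞 + 𝔞) / Real.Gamma 𝔞 ^ 2, 1, by positivity, one_pos, ?_⟩
  intro p c τ hp hc _ hτ
  have hpa : 0 < p - 𝔞 := sub_pos.2 hp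
  have hYpos : ∀ᵐ ω ∂P, 0 < Y ω :=
    ae_of_ae_map hY.aemeasurable (hYg ▸ ae_pos_gammaMeasure 𝔞 𝔟)
  have hXpos : ∀ᵐ ω ∂P, 0 < X ω :=
    ae_of_ae_map hX.aemeasurable (hXg ▸ ae_pos_gammaMeasure 𝔞 𝔟)
  have hmeas : Measurable fun ω => (c * Y ω / X ω) ^ p *
      (if c * Y ω < X ω ∧ Y ω ≤ τ then (1 : ℝ) else 0) := by
    refine Measurable.mul (by fun_prop) (Measurable.ite ?_ measurable_const measurable_const)
    exact (measurableSet_lt (hY.const_mul c) hX).inter (measurableSet_le hY measurable_const)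
  let S : Set (ℝ × ℝ) := {z | c * z.1 < z.2}
  let G : ℝ × ℝ → ℝ≥0∞ := S.indicator fun z => ENNReal.ofReal ((c * z.1 / z.2) ^ p)
  have hG : Measurable G :=
    Measurable.indicator (by fun_prop)
      (measurableSet_lt (measurable_fst.const_mul c) measurable_snd)
  have hmap : P.map (fun ω => (Y ω, X ω)) = (gammaMeasure 𝔞 𝔟).prod (gammaMeasure 𝔞 𝔟) := by
    rw [(indepFun_iff_map_prod_eq_prod_map_map hY.aemeasurable hX.aemeasurable).1 hindep.symm,
      hXg, hYg]
  have := isProbabilityMeasure_gammaMeasure h𝔞 h𝔟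
  have hinner : ∀ᵐ y ∂gammaMeasure 𝔞 𝔟, ∫⁻ x, G (y, x) ∂gammaMeasure 𝔞 𝔟 ≤
      ENNReal.ofReal (𝔟 ^ 𝔞 / Real.Gamma 𝔞 / (p - 𝔞) * c ^ 𝔞) * ENNReal.ofReal (y ^ 𝔞) := by
    filter_upwards [ae_pos_gammaMeasure 𝔞 𝔟] with y hy
    rw [← ENNReal.ofReal_mul (by positivity), mul_assoc, ← Real.mul_rpow hc.le hy.le]
    refine le_of_eq_of_le ?_
      (setLIntegral_Ioi_div_rpow_gammaMeasure_le h𝔞 h𝔟 hp (mul_pos hc hy))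
    rw [← lintegral_indicator measurableSet_Ioi]
    rfl
  rw [integral_eq_lintegral_of_nonneg_ae ?_ hmeas.aestronglyMeasurable]
  · refine ENNReal.toReal_le_of_le_ofReal (by positivity) ?_
    calc _ ≤ ∫⁻ ω, G (Y ω, X ω) ∂P := by
          refine lintegral_mono fun ω => ?_
          by_cases h : c * Y ω < X ω ∧ Y ω ≤ τ
          · simp [G, S, h]
          · simp [h]
      _ = ∫⁻ z, G z ∂(gammaMeasure 𝔞 𝔟).prod (gammaMeasure 𝔞 𝔟) := by
          rw [← hmap, lintegral_map hG (hY.prodMk hX)]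
      _ = ∫⁻ y, ∫⁻ x, G (y, x) ∂gammaMeasure 𝔞 𝔟 ∂gammaMeasure 𝔞 𝔟 :=
          lintegral_prod _ hG.aemeasurable
      _ ≤ _ := lintegral_mono_ae hinner
      _ = ENNReal.ofReal (𝔟 ^ 𝔞 / Real.Gamma 𝔞 / (p - 𝔞) * c ^ 𝔞 *
            (Real.Gamma (𝔞 + 𝔞) / (Real.Gamma 𝔞 * 𝔟 ^ 𝔞))) := by
          rw [lintegral_const_mul _ (by fun_prop),
            lintegral_rpow_gammaMeasure h𝔞 h𝔟 (add_pos h𝔞 h𝔞),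
            ← ENNReal.ofReal_mul (by positivity)]
      _ = ENNReal.ofReal (Real.Gamma (𝔞 + 𝔞) / Real.Gamma 𝔞 ^ 2 * (c ^ 𝔞 / (p - 𝔞))) := by
          congr 1
          field_simp
      _ ≤ _ := by
          gcongr
          exact le_add_of_nonneg_right (by positivity)
  · filter_upwards [hYpos, hXpos] with ω hy hx
    exact mul_nonneg (by positivity) (by split_ifs <;> norm_num)
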